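/- Let G be a primitive strongly regular graph with parameters (v,k,λ,μ) whose adjacency matrix (over ℝ) is A, and suppose 2(λ+μ) = 4k − v and 2k > v. Let B = J − I − 2A be the Seidel adjacency matrix of G and set ρ = 2k − v + 1. Then A·(ρI + B) = (k − 2μ)·(ρI + B); that is, every column of ρI + B lies in the eigenspace of A for the eigenvalue θ₂ = k − 2μ (so that ρI + B is a positive scalar multiple of the primitive idempotent E₂ of the associated Bose–Mesner algebra). -/

import Mathlib

open Finset SimpleGraph Matrix

attribute [local instance] Classical.propDecidable

/-- The adjacency matrix of a strongly regular graph satisfies a quadratic equation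
modulo the all-ones matrix. -/
theorem SimpleGraph.IsSRGWith.adjMatrix_mul_self {V : Type*} [Fintype V] [DecidableEq V]
    {G : SimpleGraph V} {v k l m : ℕ} (h : G.IsSRGWith v k l m) :
    G.adjMatrix ℝ * G.adjMatrix ℝ = (k : ℝ) • (1 : Matrix V V ℝ) + (l : ℝ) • G.adjMatrix ℝ +
      (m : ℝ) • (Matrix.of (fun _ _ => (1 : ℝ)) - 1 - G.adjMatrix ℝ) := by
  have hsq := h.matrix_eq (α := ℝ)
  rw [pow_two] at hsq
  rw [hsq]
  ext i j
  simp only [Matrix.add_apply, Matrix.sub_apply, Matrix.smul_apply, Matrix.of_apply]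
  rcases eq_or_ne i j with rfl | hij
  · simp
  · by_cases hadj : G.Adj i j <;> simp [hij, hadj]

/-- The adjacency matrix of a regular graph has constant row sums. -/
theorem SimpleGraph.IsRegularOfDegree.adjMatrix_mul_of_one {V : Type*} [Fintype V]
    {G : SimpleGraph V} {k : ℕ} (h : G.IsRegularOfDegree k) :
    G.adjMatrix ℝ * Matrix.of (fun _ _ => (1 : ℝ)) =
      (k : ℝ) • Matrix.of (fun (_ _ : V) => (1 : ℝ)) := by
  ext i j
  simp [adjMatrix_mul_apply, h i]

/-- The parameter identity of a strongly regular graph, without truncated subtraction. -/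
theorem SimpleGraph.IsSRGWith.param_eq_real {V : Type*} [Fintype V] [DecidableEq V] [Nonempty V]
    {G : SimpleGraph V} {v k l m : ℕ} (h : G.IsSRGWith v k l m) :
    (k : ℝ) * k = k + l * k + m * (v - 1 - k) := by
  obtain ⟨i⟩ := ‹Nonempty V›
  have hJ := h.regular.adjMatrix_mul_of_one
  have hJJ : Matrix.of (fun (_ _ : V) => (1 : ℝ)) * Matrix.of (fun (_ _ : V) => (1 : ℝ)) =
      (v : ℝ) • Matrix.of (fun (_ _ : V) => (1 : ℝ)) := by
    ext a b
    simp [Matrix.mul_apply, h.card]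
  have hmul := congrArg (fun M => (M * Matrix.of (fun (_ _ : V) => (1 : ℝ))) i i)
    h.adjMatrix_mul_self
  simpa only [Matrix.mul_assoc, Matrix.add_mul, Matrix.sub_mul, Matrix.smul_mul, Matrix.mul_smul,
    Matrix.one_mul, hJ, hJJ, Matrix.add_apply, Matrix.sub_apply, Matrix.smul_apply,
    Matrix.of_apply, smul_eq_mul, mul_one] using hmul

theorem seidel_idempotent_eigen_neg
    {V : Type*} [Fintype V] [DecidableEq V] (G : SimpleGraph V)
    (v k l m : ℕ) (hsrg : G.IsSRGWith v k l m)
    (hprim : G.Connected ∧ Gᶜ.Connected)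
    (hcond : 2 * (l + m) + v = 4 * k) (hkv : 2 * k > v) :
    G.adjMatrix ℝ *
        ((2 * (k : ℝ) - v + 1) • (1 : Matrix V V ℝ) +
          (Matrix.of (fun _ _ => (1 : ℝ)) - 1 - 2 • G.adjMatrix ℝ)) =
      ((k : ℝ) - 2 * m) •
        ((2 * (k : ℝ) - v + 1) • (1 : Matrix V V ℝ) +
          (Matrix.of (fun _ _ => (1 : ℝ)) - 1 - 2 • G.adjMatrix ℝ)) := by
  have := hprim.1.nonempty
  have hparam := hsrg.param_eq_real
  have hl : 2 * ((l : ℝ) + m) + v = 4 * k := by exact_mod_cast hcond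
  have hA : G.adjMatrix ℝ * (2 • G.adjMatrix ℝ) = 2 • (G.adjMatrix ℝ * G.adjMatrix ℝ) :=
    Matrix.mul_smul _ _ _
  rw [Matrix.mul_add, Matrix.mul_sub, Matrix.mul_sub, hA, Matrix.mul_smul, Matrix.mul_one,
    hsrg.regular.adjMatrix_mul_of_one, hsrg.adjMatrix_mul_self]
  have hlv : (l : ℝ) = 2 * k - v / 2 - m := by linarith
  rw [hlv] at hparam ⊢
  have hdiag : ((k : ℝ) - 2 * m) * (2 * k - v) = 2 * m - 2 * k := by linarith
  ext i j
  simp only [Matrix.add_apply, Matrix.sub_apply, Matrix.smul_apply, Matrix.of_apply, smul_eq_mul,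
    two_nsmul]
  linear_combination -(1 : Matrix V V ℝ) i j * hdiag
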